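/- Let n ≥ 1 and let c_1,…,c_n ≥ 0 be nonnegative reals with Σ_{α=1}^n c_α > 0. Define F(Y) := −Σ_{α=1}^n (c_α/C_n^α) · S_α(Y^{−1}) on the open set of n×n positive definite Hermitian matrices. Then F is differentiable at every positive definite Hermitian X, and for every nonzero positive semidefinite Hermitian matrix H the Fréchet derivative satisfies DF(X)[H] > 0 (ellipticity of the operator F). -/

import Mathlib

open scoped ComplexOrder

/-- `S n k lam` is the `k`-th elementary symmetric polynomial of `lam ∈ ℝⁿ`,
with the conventions `S n 0 lam = 1` and `S n k lam = 0` for `k > n`. -/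
noncomputable def S (n k : ℕ) (lam : Fin n → ℝ) : ℝ :=
  ∑ A ∈ Finset.powersetCard k (Finset.univ : Finset (Fin n)), ∏ i ∈ A, lam i

/-- `Si n k i lam` is `S_k` evaluated at `lam` with its `i`-th entry replaced by `0`. -/
noncomputable def Si (n k : ℕ) (i : Fin n) (lam : Fin n → ℝ) : ℝ :=
  S n k (Function.update lam i 0)

/-- `Sm α Y` is the `α`-th elementary symmetric polynomial of the eigenvalues of `Y`,
i.e. `(−1)^α` times the coefficient of `t^{n−α}` in the characteristic polynomial
`det (t·I − Y)` (for Hermitian `Y` this is real, so we take the real part). -/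
noncomputable def Sm {n : ℕ} (α : ℕ) (Y : Matrix (Fin n) (Fin n) ℂ) : ℝ :=
  ((-1 : ℂ) ^ α * Y.charpoly.coeff (n - α)).re

attribute [local instance] Matrix.normedAddCommGroup Matrix.normedSpace

/-- The operator `F(Y) = −Σ_α (c_α/C_n^α)·S_α(Y⁻¹)`. -/
noncomputable def Fop (n : ℕ) (c : ℕ → ℝ) (Y : Matrix (Fin n) (Fin n) ℂ) : ℝ :=
  -∑ α ∈ Finset.Icc 1 n, (c α / (n.choose α : ℝ)) * Sm α Y⁻¹

section

variable {E : Type*} [NormedAddCommGroup E] [NormedSpace ℝ E]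

theorem differentiableAt_matrix_det {m : Type*} [Fintype m] [DecidableEq m]
    {M : E → Matrix m m ℂ} {x : E} (hM : ∀ i j, DifferentiableAt ℝ (fun y => M y i j) x) :
    DifferentiableAt ℝ (fun y => (M y).det) x := by
  simp only [Matrix.det_apply']
  exact DifferentiableAt.fun_sum fun σ _ =>
    (HasFDerivAt.finsetProd fun i _ => (hM (σ i) i).hasFDerivAt).differentiableAt.const_mul _

theorem differentiableAt_matrix_inv_apply {m : Type*} [Fintype m] [DecidableEq m]
    {M : E → Matrix m m ℂ} {x : E} (hM : ∀ i j, DifferentiableAt ℝ (fun y => M y i j) x)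
    (hx : (M x).det ≠ 0) (i j : m) : DifferentiableAt ℝ (fun y => (M y)⁻¹ i j) x := by
  simp only [Matrix.inv_def, Matrix.smul_apply, Ring.inverse_eq_inv', smul_eq_mul,
    Matrix.adjugate_apply]
  refine ((differentiableAt_matrix_det hM).inv hx).mul (differentiableAt_matrix_det fun k l => ?_)
  by_cases hk : k = j <;> simp [Matrix.updateRow_apply, hk, hM]

end

theorem Sm_eq_sum_minors {n α : ℕ} (hα : α ≤ n) (Y : Matrix (Fin n) (Fin n) ℂ) :
    Sm α Y = ∑ A ∈ Finset.univ.powersetCard α,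
      (Y.submatrix (Subtype.val : A → Fin n) Subtype.val).det.re := by
  have h := Y.charpoly_coeff_eq_sum_minors α (by simpa using hα)
  rw [Fintype.card_fin] at h
  rw [Sm, h, ← mul_assoc, ← mul_pow]
  simp

theorem differentiableAt_Fop {n : ℕ} (c : ℕ → ℝ) {X : Matrix (Fin n) (Fin n) ℂ}
    (hX : X.det ≠ 0) : DifferentiableAt ℝ (Fop n c) X := by
  unfold Fop
  refine (DifferentiableAt.fun_sum fun α hα => DifferentiableAt.const_mul ?_ _).neg
  simp only [Sm_eq_sum_minors (Finset.mem_Icc.mp hα).2]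
  refine DifferentiableAt.fun_sum fun A _ => ?_
  refine Complex.reCLM.differentiableAt.comp X (differentiableAt_matrix_det fun i j => ?_)
  refine differentiableAt_matrix_inv_apply (M := fun Y => Y) (fun k l => ?_) hX i j
  exact differentiableAt_pi.mp (differentiableAt_pi.mp differentiableAt_id k) l

open scoped MatrixOrder in
/-- Simultaneous diagonalization by congruence of a positive definite and a positive semidefinite
matrix. -/
theorem Matrix.PosDef.exists_simultaneous_diagonalization {m : Type*} [Fintype m] [DecidableEq m]
    {X H : Matrix m m ℂ} (hX : X.PosDef) (hH : H.PosSemidef) :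
    ∃ (P : Matrix m m ℂ) (μ : m → ℝ), IsUnit P ∧ 0 ≤ μ ∧ X = P * P.conjTranspose ∧
      H = P * Matrix.diagonal (fun i => (μ i : ℂ)) * P.conjTranspose := by
  obtain ⟨B, hB, rfl⟩ :=
    CStarAlgebra.isStrictlyPositive_iff_eq_mul_star_self.mp hX.isStrictlyPositive
  have hK : (B⁻¹ * H * B⁻¹.conjTranspose).PosSemidef := hH.mul_mul_conjTranspose_same _
  have hdet : IsUnit B.det := (Matrix.isUnit_iff_isUnit_det B).mp hB
  set U := hK.1.eigenvectorUnitary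
  have hspec : B⁻¹ * H * B⁻¹.conjTranspose =
      U * Matrix.diagonal (fun i => (hK.1.eigenvalues i : ℂ)) * star (U : Matrix m m ℂ) :=
    hK.1.spectral_theorem
  refine ⟨B * U, hK.1.eigenvalues, hB.mul (Unitary.toUnits U).isUnit, hK.eigenvalues_nonneg, ?_, ?_⟩
  · rw [Matrix.conjTranspose_mul, ← Matrix.star_eq_conjTranspose, ← Matrix.star_eq_conjTranspose,
      mul_assoc, ← mul_assoc (U : Matrix m m ℂ), Unitary.mul_star_self_of_mem U.2,
      one_mul]
  · calc H = B * (B⁻¹ * H * B⁻¹.conjTranspose) * B.conjTranspose := by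
          have h : B⁻¹.conjTranspose * B.conjTranspose = 1 := by
            rw [← Matrix.conjTranspose_mul, Matrix.mul_nonsing_inv B hdet,
              Matrix.conjTranspose_one]
          rw [mul_assoc, mul_assoc, h, mul_one, Matrix.mul_nonsing_inv_cancel_left _ _ hdet]
      _ = _ := by
          refine (congrArg (fun K => B * K * B.conjTranspose) hspec).trans ?_
          rw [Matrix.conjTranspose_mul, ← Matrix.star_eq_conjTranspose (U : Matrix m m ℂ)]
          simp only [mul_assoc]

theorem Sm_conj_inv {n α : ℕ} (hα : α ≤ n) {P : Matrix (Fin n) (Fin n) ℂ} (d : Fin n → ℝ)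
    (hd : ∀ i, d i ≠ 0) :
    Sm α (P * Matrix.diagonal (fun i => (d i : ℂ)) * P.conjTranspose)⁻¹ =
      ∑ A ∈ Finset.univ.powersetCard α, (∏ i ∈ A, (d i)⁻¹) *
        ((P.conjTranspose * P)⁻¹.submatrix (Subtype.val : A → Fin n) Subtype.val).det.re := by
  have hinv : (Matrix.diagonal (fun i => (d i : ℂ)))⁻¹ =
      Matrix.diagonal (fun i => (((d i)⁻¹ : ℝ) : ℂ)) :=
    Matrix.inv_eq_right_inv (by
      rw [Matrix.diagonal_mul_diagonal, ← Matrix.diagonal_one]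
      congr 1
      ext i
      simp [hd i])
  have hSm : Sm α (P * Matrix.diagonal (fun i => (d i : ℂ)) * P.conjTranspose)⁻¹ =
      Sm α (Matrix.diagonal (fun i => (((d i)⁻¹ : ℝ) : ℂ)) * (P.conjTranspose * P)⁻¹) := by
    simp only [Sm]
    rw [Matrix.mul_inv_rev, Matrix.mul_inv_rev, Matrix.mul_inv_rev, hinv, ← mul_assoc,
      Matrix.charpoly_mul_comm, ← mul_assoc, Matrix.charpoly_mul_comm]
  rw [hSm, Sm_eq_sum_minors hα]
  refine Finset.sum_congr rfl fun A _ => ?_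
  have hsub : (Matrix.diagonal (fun i => (((d i)⁻¹ : ℝ) : ℂ)) *
      (P.conjTranspose * P)⁻¹).submatrix (Subtype.val : A → Fin n) Subtype.val =
      Matrix.of fun i j : A => (((d i)⁻¹ : ℝ) : ℂ) *
        ((P.conjTranspose * P)⁻¹.submatrix (Subtype.val : A → Fin n) Subtype.val) i j := by
    ext i j
    simp [Matrix.diagonal_mul]
  rw [hsub, Matrix.det_mul_column, Finset.prod_coe_sort A (fun i => (((d i)⁻¹ : ℝ) : ℂ)),
    ← Complex.ofReal_prod, Complex.re_ofReal_mul]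

theorem hasDerivAt_prod_one_add_mul_inv {ι : Type*} [DecidableEq ι] (A : Finset ι) (μ : ι → ℝ) :
    HasDerivAt (fun s : ℝ => ∏ i ∈ A, (1 + s * μ i)⁻¹) (-∑ i ∈ A, μ i) 0 := by
  have h := HasDerivAt.fun_finsetProd (u := A) (f := fun i (s : ℝ) => (1 + s * μ i)⁻¹)
    (f' := fun i => -μ i) (x := 0) fun i _ => by
      have h := (((hasDerivAt_id (0 : ℝ)).mul_const (μ i)).const_add 1).inv (by simp)
      simpa using! h
  simpa using h

/-- Ellipticity: `F` is differentiable at every positive definite Hermitian `X`,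
and `DF(X)[H] > 0` for every nonzero positive semidefinite Hermitian `H`. -/
theorem Fop_elliptic (n : ℕ) (hn : 1 ≤ n) (c : ℕ → ℝ)
    (hc : ∀ α ∈ Finset.Icc 1 n, 0 ≤ c α) (hcpos : 0 < ∑ α ∈ Finset.Icc 1 n, c α)
    (X : Matrix (Fin n) (Fin n) ℂ) (hX : X.PosDef) :
    ∃ D : Matrix (Fin n) (Fin n) ℂ →L[ℝ] ℝ, HasFDerivAt (Fop n c) D X ∧
      ∀ H : Matrix (Fin n) (Fin n) ℂ, H.PosSemidef → H ≠ 0 → 0 < D H := by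
  have hdiff := (differentiableAt_Fop c hX.det_pos.ne').hasFDerivAt
  refine ⟨_, hdiff, fun H hH hH0 => ?_⟩
  obtain ⟨P, μ, hP, hμ, hXP, hHP⟩ := hX.exists_simultaneous_diagonalization hH
  set m : Finset (Fin n) → ℝ := fun A =>
    ((P.conjTranspose * P)⁻¹.submatrix (Subtype.val : A → Fin n) Subtype.val).det.re
  have hmpos : ∀ A, 0 < m A := fun A =>
    (Complex.pos_iff.mp (((Matrix.PosDef.conjTranspose_mul_self P
      (Matrix.mulVec_injective_of_isUnit hP)).inv.submatrix Subtype.val_injective).det_pos)).1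
  obtain ⟨k, hk⟩ : ∃ k, 0 < μ k := by
    by_contra! hall
    have hμ0 : μ = 0 := le_antisymm hall hμ
    exact hH0 (by simp [hHP, hμ0])
  have hline : HasDerivAt (fun s : ℝ => Fop n c (X + s • H)) (fderiv ℝ (Fop n c) X H) 0 := by
    have h : HasDerivAt (fun s : ℝ => X + s • H) H 0 := by
      have h := ((hasDerivAt_id (0 : ℝ)).smul_const H).const_add X
      rwa [one_smul] at h
    exact HasFDerivAt.comp_hasDerivAt_of_eq 0 hdiff h (by simp)
  have hexplicit : HasDerivAt (fun s : ℝ => -∑ α ∈ Finset.Icc 1 n, (c α / (n.choose α : ℝ)) *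
      ∑ A ∈ Finset.univ.powersetCard α, (∏ i ∈ A, (1 + s * μ i)⁻¹) * m A)
      (-∑ α ∈ Finset.Icc 1 n, (c α / (n.choose α : ℝ)) *
        ∑ A ∈ Finset.univ.powersetCard α, (-∑ i ∈ A, μ i) * m A) 0 :=
    (HasDerivAt.fun_sum fun α _ => (HasDerivAt.fun_sum fun A _ =>
      (hasDerivAt_prod_one_add_mul_inv A μ).mul_const _).const_mul _).neg
  have hev : (fun s : ℝ => Fop n c (X + s • H)) =ᶠ[nhds 0] fun s : ℝ =>
      -∑ α ∈ Finset.Icc 1 n, (c α / (n.choose α : ℝ)) *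
        ∑ A ∈ Finset.univ.powersetCard α, (∏ i ∈ A, (1 + s * μ i)⁻¹) * m A := by
    have hne : ∀ᶠ s : ℝ in nhds 0, ∀ i, 1 + s * μ i ≠ 0 :=
      Filter.eventually_all.mpr fun i =>
        ContinuousAt.eventually_ne (by fun_prop) (by simp)
    filter_upwards [hne] with s hs
    have hXs : X + s • H =
        P * Matrix.diagonal (fun i => ((1 + s * μ i : ℝ) : ℂ)) * P.conjTranspose := by
      have hdiag : Matrix.diagonal (fun i => ((1 + s * μ i : ℝ) : ℂ)) =
          1 + s • Matrix.diagonal (fun i => (μ i : ℂ)) := by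
        ext i j
        by_cases hij : i = j <;> simp [hij]
      rw [hdiag, mul_add, add_mul, mul_one, mul_smul_comm, smul_mul_assoc, ← hXP, ← hHP]
    rw [hXs, Fop]
    exact congrArg _ (Finset.sum_congr rfl fun α hα => by
      rw [Sm_conj_inv (Finset.mem_Icc.mp hα).2 _ hs])
  rw [hline.unique (hexplicit.congr_of_eventuallyEq hev)]
  simp only [neg_mul, Finset.sum_neg_distrib, mul_neg, neg_neg]
  have hnonneg : ∀ A : Finset (Fin n), 0 ≤ (∑ i ∈ A, μ i) * m A := fun A =>
    mul_nonneg (Finset.sum_nonneg fun i _ => hμ i) (hmpos A).le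
  obtain ⟨β, hβ, hcβ⟩ : ∃ β ∈ Finset.Icc 1 n, 0 < c β := by
    by_contra! hall
    exact hcpos.not_ge (Finset.sum_nonpos hall)
  refine Finset.sum_pos' (fun α hα => mul_nonneg (div_nonneg (hc α hα) (Nat.cast_nonneg _))
    (Finset.sum_nonneg fun A _ => hnonneg A)) ⟨β, hβ, ?_⟩
  obtain ⟨hβ1, hβn⟩ := Finset.mem_Icc.mp hβ
  obtain ⟨A, hkA, -, hA⟩ := Finset.exists_subsuperset_card_eq
    (Finset.subset_univ {k}) (by simpa using hβ1) (by simpa using hβn)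
  refine mul_pos (div_pos hcβ (Nat.cast_pos.mpr (Nat.choose_pos hβn)))
    (Finset.sum_pos' (fun A _ => hnonneg A) ⟨A, by simp [hA], mul_pos ?_ (hmpos A)⟩)
  exact Finset.sum_pos' (fun i _ => hμ i) ⟨k, by simpa using hkA, hk⟩
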